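/- Let k, l, r, p be positive integers with p ≤ l, and let U, Û ∈ ℝ^{(k+l)×r} satisfy UᵀU = ÛᵀÛ = I_r. Write M, M̂ ∈ ℝ^{k×r} for the first k rows of U, Û, write Y_f, Ŷ_f ∈ ℝ^{l×r} for the last l rows, and write Y_f^{(1)}, Ŷ_f^{(1)} ∈ ℝ^{p×r} for the first p rows of Y_f, Ŷ_f. Let s > 0 satisfy ‖M̂·x‖₂ ≥ s·‖x‖₂ for all x ∈ ℝ^r. If κ := (1/√2)·‖UUᵀ − ÛÛᵀ‖_F ≤ s/(2√2), then M has full column rank, ‖M·x‖₂ ≥ (s/2)·‖x‖₂ for all x ∈ ℝ^r, and for every b ∈ ℝ^k the one-step prediction error satisfies ‖Ŷ_f^{(1)}·M̂†·b − Y_f^{(1)}·M†·b‖₂ ≤ (2(1+√5)·‖Ŷ_f^{(1)}‖₂/s² + 1/s)·√2·κ·‖b‖₂. -/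

import Mathlib

open Matrix BigOperators

/-- Euclidean norm of a real vector. -/
noncomputable def euclNorm {ι : Type*} [Fintype ι] (v : ι → ℝ) : ℝ :=
  Real.sqrt (∑ i, (v i) ^ 2)

/-- Frobenius norm of a real matrix. -/
noncomputable def frobNorm {ι κ : Type*} [Fintype ι] [Fintype κ] (M : Matrix ι κ ℝ) : ℝ :=
  Real.sqrt (∑ i, ∑ j, (M i j) ^ 2)

/-- Spectral (ℓ²-operator) norm of a real matrix. -/
noncomputable def specNorm {ι κ : Type*} [Fintype ι] [Fintype κ] (M : Matrix ι κ ℝ) : ℝ :=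
  sSup {c | ∃ x : κ → ℝ, euclNorm x = 1 ∧ c = euclNorm (M.mulVec x)}

/-- Moore–Penrose pseudoinverse of a full-column-rank matrix: M† = (MᵀM)⁻¹Mᵀ. -/
noncomputable def pinv {ι κ : Type*} [Fintype ι] [Fintype κ] [DecidableEq κ]
    (M : Matrix ι κ ℝ) : Matrix κ ι ℝ :=
  (Mᵀ * M)⁻¹ * Mᵀ

theorem euclNorm_nonneg {ι : Type*} [Fintype ι] (v : ι → ℝ) : 0 ≤ euclNorm v :=
  Real.sqrt_nonneg _

theorem euclNorm_sq {ι : Type*} [Fintype ι] (v : ι → ℝ) : euclNorm v ^ 2 = v ⬝ᵥ v := by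
  rw [euclNorm, Real.sq_sqrt (Finset.sum_nonneg fun i _ => sq_nonneg _)]
  simp [dotProduct, sq]

theorem euclNorm_eq_norm {ι : Type*} [Fintype ι] (v : ι → ℝ) :
    euclNorm v = ‖WithLp.toLp 2 v‖ := by
  simp [euclNorm, EuclideanSpace.norm_eq]

theorem euclNorm_add_le {ι : Type*} [Fintype ι] (v w : ι → ℝ) :
    euclNorm (v + w) ≤ euclNorm v + euclNorm w := by
  simpa only [euclNorm_eq_norm, WithLp.toLp_add] using norm_add_le _ _

theorem euclNorm_sub_le {ι : Type*} [Fintype ι] (v w : ι → ℝ) :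
    euclNorm (v - w) ≤ euclNorm v + euclNorm w := by
  simpa only [euclNorm_eq_norm, WithLp.toLp_sub] using norm_sub_le _ _

theorem euclNorm_smul {ι : Type*} [Fintype ι] (c : ℝ) (v : ι → ℝ) :
    euclNorm (c • v) = |c| * euclNorm v := by
  rw [euclNorm_eq_norm, euclNorm_eq_norm, WithLp.toLp_smul, norm_smul, Real.norm_eq_abs]

theorem euclNorm_eq_zero {ι : Type*} [Fintype ι] {v : ι → ℝ} : euclNorm v = 0 ↔ v = 0 := by
  rw [euclNorm_eq_norm, norm_eq_zero, WithLp.toLp_eq_zero]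

theorem abs_dotProduct_le {ι : Type*} [Fintype ι] (v w : ι → ℝ) :
    |v ⬝ᵥ w| ≤ euclNorm v * euclNorm w := by
  refine abs_le_of_sq_le_sq ?_ (mul_nonneg (euclNorm_nonneg _) (euclNorm_nonneg _))
  rw [mul_pow, euclNorm_sq, euclNorm_sq]
  simpa [dotProduct, sq] using Finset.sum_mul_sq_le_sq_mul_sq Finset.univ v w

theorem frobNorm_nonneg {ι κ : Type*} [Fintype ι] [Fintype κ] (M : Matrix ι κ ℝ) :
    0 ≤ frobNorm M :=
  Real.sqrt_nonneg _

theorem frobNorm_sq {ι κ : Type*} [Fintype ι] [Fintype κ] (M : Matrix ι κ ℝ) :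
    frobNorm M ^ 2 = (Mᵀ * M).trace := by
  rw [frobNorm, Real.sq_sqrt
    (Finset.sum_nonneg fun i _ => Finset.sum_nonneg fun j _ => sq_nonneg (M i j)), Finset.sum_comm]
  simp [Matrix.trace, Matrix.mul_apply, sq]

theorem euclNorm_mulVec_le_frobNorm {ι κ : Type*} [Fintype ι] [Fintype κ]
    (M : Matrix ι κ ℝ) (x : κ → ℝ) : euclNorm (M *ᵥ x) ≤ frobNorm M * euclNorm x := by
  rw [euclNorm, frobNorm, euclNorm, ← Real.sqrt_mul
    (Finset.sum_nonneg fun i _ => Finset.sum_nonneg fun j _ => sq_nonneg (M i j)), Finset.sum_mul]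
  refine Real.sqrt_le_sqrt (Finset.sum_le_sum fun i _ => ?_)
  exact Finset.sum_mul_sq_le_sq_mul_sq Finset.univ (M i) x

theorem specNorm_nonneg {ι κ : Type*} [Fintype ι] [Fintype κ] (M : Matrix ι κ ℝ) :
    0 ≤ specNorm M := by
  apply Real.sSup_nonneg
  rintro _ ⟨x, -, rfl⟩
  exact euclNorm_nonneg _

theorem euclNorm_mulVec_le_specNorm {ι κ : Type*} [Fintype ι] [Fintype κ]
    (M : Matrix ι κ ℝ) (x : κ → ℝ) : euclNorm (M *ᵥ x) ≤ specNorm M * euclNorm x := by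
  by_cases hx : x = 0
  · simp [hx, euclNorm]
  have hpos : 0 < euclNorm x :=
    (euclNorm_nonneg x).lt_of_ne' (mt euclNorm_eq_zero.mp hx)
  have hbdd : BddAbove {c | ∃ x : κ → ℝ, euclNorm x = 1 ∧ c = euclNorm (M.mulVec x)} := by
    refine ⟨frobNorm M, ?_⟩
    rintro _ ⟨y, hy, rfl⟩
    simpa [hy] using euclNorm_mulVec_le_frobNorm M y
  have hle : euclNorm (M *ᵥ ((euclNorm x)⁻¹ • x)) ≤ specNorm M := by
    refine le_csSup hbdd ⟨_, ?_, rfl⟩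
    rw [euclNorm_smul, abs_of_pos (inv_pos.mpr hpos), inv_mul_cancel₀ hpos.ne']
  rw [Matrix.mulVec_smul, euclNorm_smul, abs_of_pos (inv_pos.mpr hpos), inv_mul_le_iff₀ hpos] at hle
  linarith

/-- The chordal distance is the Frobenius norm of the residual of projecting one orthonormal
frame onto the column space of the other. -/
theorem frobNorm_proj_sub {n r : Type*} [Fintype n] [Fintype r] [DecidableEq r]
    (U V : Matrix n r ℝ) (hU : Uᵀ * U = 1) (hV : Vᵀ * V = 1) :
    frobNorm (U * (Uᵀ * V) - V) = (1 / Real.sqrt 2) * frobNorm (U * Uᵀ - V * Vᵀ) := by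
  have hsq : 2 * frobNorm (U * (Uᵀ * V) - V) ^ 2 = frobNorm (U * Uᵀ - V * Vᵀ) ^ 2 := by
    have e1 : (U * (Uᵀ * V) - V)ᵀ * (U * (Uᵀ * V) - V) = 1 - (Vᵀ * U) * (Uᵀ * V) := by
      have : Vᵀ * U * Uᵀ * (U * (Uᵀ * V)) = Vᵀ * U * ((Uᵀ * U) * (Uᵀ * V)) := by
        simp only [Matrix.mul_assoc]
      simp only [Matrix.transpose_sub, Matrix.transpose_mul, Matrix.transpose_transpose,
        Matrix.sub_mul, Matrix.mul_sub, hV, this, hU, Matrix.one_mul]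
      simp only [Matrix.mul_assoc]
      abel
    have e2 : (U * Uᵀ - V * Vᵀ)ᵀ * (U * Uᵀ - V * Vᵀ)
        = U * Uᵀ + V * Vᵀ - (U * Uᵀ) * (V * Vᵀ) - (V * Vᵀ) * (U * Uᵀ) := by
      have h1 : U * Uᵀ * (U * Uᵀ) = U * ((Uᵀ * U) * Uᵀ) := by simp only [Matrix.mul_assoc]
      have h2 : V * Vᵀ * (V * Vᵀ) = V * ((Vᵀ * V) * Vᵀ) := by simp only [Matrix.mul_assoc]
      simp only [Matrix.transpose_sub, Matrix.transpose_mul, Matrix.transpose_transpose,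
        Matrix.sub_mul, Matrix.mul_sub, h1, h2, hU, hV, Matrix.one_mul]
      abel
    have t1 : (U * Uᵀ).trace = (1 : Matrix r r ℝ).trace := by rw [Matrix.trace_mul_comm, hU]
    have t2 : (V * Vᵀ).trace = (1 : Matrix r r ℝ).trace := by rw [Matrix.trace_mul_comm, hV]
    have t3 : (U * Uᵀ * (V * Vᵀ)).trace = (Vᵀ * U * (Uᵀ * V)).trace := by
      rw [← Matrix.mul_assoc, Matrix.trace_mul_comm]
      simp only [Matrix.mul_assoc]
    have t4 : (V * Vᵀ * (U * Uᵀ)).trace = (Vᵀ * U * (Uᵀ * V)).trace := by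
      rw [Matrix.trace_mul_comm, t3]
    rw [frobNorm_sq, frobNorm_sq, e1, e2]
    simp only [Matrix.trace_sub, Matrix.trace_add, t1, t2, t3, t4]
    ring
  have h2 : (0 : ℝ) < Real.sqrt 2 := by positivity
  refine (sq_eq_sq₀ (frobNorm_nonneg _) (mul_nonneg (by positivity) (frobNorm_nonneg _))).mp ?_
  rw [mul_pow, ← hsq, div_pow, Real.sq_sqrt (by norm_num)]
  ring

/-- The squared norms of two disjoint row blocks of a vector are bounded by its squared norm. -/
theorem euclNorm_sq_blocks_le {k l p : ℕ} (hpl : p ≤ l) (v : Fin (k + l) → ℝ) :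
    euclNorm (fun i : Fin k => v (Fin.castAdd l i)) ^ 2 +
      euclNorm (fun i : Fin p => v (Fin.natAdd k (Fin.castLE hpl i))) ^ 2 ≤ euclNorm v ^ 2 := by
  simp only [euclNorm_sq, dotProduct, Fin.sum_univ_add]
  gcongr
  refine (Finset.sum_map Finset.univ (Fin.castLEEmb hpl)
    (fun i => v (Fin.natAdd k i) * v (Fin.natAdd k i))).ge.trans ?_
  exact Finset.sum_le_univ_sum_of_nonneg fun i => mul_self_nonneg _

theorem mulVec_injective_of_lower_bound {ι κ : Type*} [Fintype ι] [Fintype κ]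
    {M : Matrix ι κ ℝ} {c : ℝ} (hc : 0 < c)
    (h : ∀ x, c * euclNorm x ≤ euclNorm (M *ᵥ x)) : Function.Injective M.mulVec := by
  intro x y hxy
  have h0 : M *ᵥ (x - y) = 0 := by rw [Matrix.mulVec_sub, sub_eq_zero]; exact hxy
  have hle := h (x - y)
  rw [h0, euclNorm_eq_zero.mpr rfl] at hle
  exact sub_eq_zero.mp (euclNorm_eq_zero.mp
    (le_antisymm (nonpos_of_mul_nonpos_right hle hc) (euclNorm_nonneg _)))

/-- The pseudoinverse of a matrix with full column rank solves the normal equations. -/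
theorem transpose_mulVec_mulVec_pinv {ι κ : Type*} [Fintype ι] [Fintype κ] [DecidableEq κ]
    {M : Matrix ι κ ℝ} (hM : Function.Injective M.mulVec) (b : ι → ℝ) :
    Mᵀ *ᵥ (M *ᵥ (pinv M *ᵥ b)) = Mᵀ *ᵥ b := by
  have hunit : IsUnit (Mᵀ * M) := by
    rw [← Matrix.mulVec_injective_iff_isUnit]
    intro x y hxy
    apply hM
    rw [← sub_eq_zero, ← Matrix.mulVec_sub, ← dotProduct_self_eq_zero]
    have h0 : (Mᵀ * M) *ᵥ (x - y) = 0 := by rw [Matrix.mulVec_sub, sub_eq_zero]; exact hxy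
    rw [Matrix.dotProduct_mulVec, ← Matrix.mulVec_transpose, Matrix.mulVec_mulVec, h0,
      zero_dotProduct]
  rw [Matrix.mulVec_mulVec, Matrix.mulVec_mulVec, pinv, ← Matrix.mul_assoc,
    Matrix.mul_nonsing_inv _ ((Matrix.isUnit_iff_isUnit_det _).mp hunit), Matrix.one_mul]

/-- Perturbation bound for least-squares solutions. -/
theorem leastSquares_sub_le {ι κ : Type*} [Fintype ι] [Fintype κ]
    {A B : Matrix ι κ ℝ} {s ε : ℝ} (hs : 0 < s) (hε : 0 ≤ ε) (hεs : 2 * ε ≤ s)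
    (hA : ∀ x, s * euclNorm x ≤ euclNorm (A *ᵥ x))
    (hAB : ∀ x, euclNorm ((B - A) *ᵥ x) ≤ ε * euclNorm x)
    {b : ι → ℝ} {x y : κ → ℝ} (hx : Aᵀ *ᵥ (A *ᵥ x) = Aᵀ *ᵥ b) (hy : Bᵀ *ᵥ (B *ᵥ y) = Bᵀ *ᵥ b) :
    euclNorm (B *ᵥ y) ≤ euclNorm b ∧
      euclNorm (x - y) ≤ 3 * ε / s ^ 2 * euclNorm b := by
  have orth : ∀ z, (B *ᵥ z) ⬝ᵥ (b - B *ᵥ y) = 0 := fun z => by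
    rw [dotProduct_comm, Matrix.dotProduct_mulVec, ← Matrix.mulVec_transpose, Matrix.mulVec_sub,
      hy, sub_self, zero_dotProduct]
  have orthA : ∀ z, (A *ᵥ z) ⬝ᵥ (b - A *ᵥ x) = 0 := fun z => by
    rw [dotProduct_comm, Matrix.dotProduct_mulVec, ← Matrix.mulVec_transpose, Matrix.mulVec_sub,
      hx, sub_self, zero_dotProduct]
  have pyth : euclNorm b ^ 2 = euclNorm (B *ᵥ y) ^ 2 + euclNorm (b - B *ᵥ y) ^ 2 := by
    have h := orth y
    rw [dotProduct_sub] at h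
    simp only [euclNorm_sq, sub_dotProduct, dotProduct_sub]
    rw [dotProduct_comm b (B *ᵥ y)]
    linarith
  have hBy : euclNorm (B *ᵥ y) ≤ euclNorm b :=
    le_of_sq_le_sq (by nlinarith [sq_nonneg (euclNorm (b - B *ᵥ y))]) (euclNorm_nonneg _)
  have hres : euclNorm (b - B *ᵥ y) ≤ euclNorm b :=
    le_of_sq_le_sq (by nlinarith [sq_nonneg (euclNorm (B *ᵥ y))]) (euclNorm_nonneg _)
  refine ⟨hBy, ?_⟩
  have hyb : s * euclNorm y ≤ 2 * euclNorm b := by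
    have h1 := euclNorm_sub_le (B *ᵥ y) ((B - A) *ᵥ y)
    rw [← Matrix.sub_mulVec, sub_sub_cancel] at h1
    nlinarith [hA y, hAB y, euclNorm_nonneg y]
  have hd := hA (x - y)
  have hEd := hAB (x - y)
  have hEy := hAB y
  set d := x - y with hdef
  have key : euclNorm (A *ᵥ d) ^ 2 =
      -(((B - A) *ᵥ d) ⬝ᵥ (b - B *ᵥ y)) + (A *ᵥ d) ⬝ᵥ ((B - A) *ᵥ y) := by
    have h1 := orth d
    have h2 := orthA d
    rw [euclNorm_sq]
    nth_rewrite 2 [hdef]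
    simp only [Matrix.mulVec_sub, Matrix.sub_mulVec, dotProduct_sub, sub_dotProduct] at h1 h2 ⊢
    linarith
  have c1 := neg_abs_le (((B - A) *ᵥ d) ⬝ᵥ (b - B *ᵥ y))
  have c2 := abs_dotProduct_le ((B - A) *ᵥ d) (b - B *ᵥ y)
  have c3 := (le_abs_self _).trans (abs_dotProduct_le (A *ᵥ d) ((B - A) *ᵥ y))
  have hb0 := euclNorm_nonneg b
  have hd0 := euclNorm_nonneg d
  have hAd0 := euclNorm_nonneg (A *ᵥ d)
  have c4 : euclNorm ((B - A) *ᵥ d) * euclNorm (b - B *ᵥ y) ≤ ε * euclNorm d * euclNorm b :=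
    mul_le_mul hEd hres (euclNorm_nonneg _) (by positivity)
  have c5 : euclNorm (A *ᵥ d) * euclNorm ((B - A) *ᵥ y) ≤ euclNorm (A *ᵥ d) * (ε * euclNorm y) :=
    mul_le_mul_of_nonneg_left hEy hAd0
  have c6 : s * (ε * euclNorm d * euclNorm b) ≤ euclNorm (A *ᵥ d) * (ε * euclNorm b) := by
    nlinarith [mul_le_mul_of_nonneg_right hd (mul_nonneg hε hb0)]
  have c7 : s * (euclNorm (A *ᵥ d) * (ε * euclNorm y)) ≤
      euclNorm (A *ᵥ d) * (ε * (2 * euclNorm b)) := by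
    nlinarith [mul_le_mul_of_nonneg_right hyb (mul_nonneg hε hAd0)]
  have c8 : s * euclNorm (A *ᵥ d) ≤ 3 * ε * euclNorm b := by
    rcases hAd0.eq_or_lt with h | h
    · rw [← h, mul_zero]; positivity
    · refine le_of_mul_le_mul_left ?_ h
      nlinarith
  rw [div_mul_eq_mul_div, le_div_iff₀ (by positivity)]
  nlinarith [mul_le_mul_of_nonneg_left hd hs.le]

/-- Corollary 1 of the paper: one-step prediction error bound whose
constant depends only on the smallest singular value of the estimated predictor matrix. -/
theorem one_step_prediction_error_bound
    (k l r p : ℕ) (hk : 0 < k) (hl : 0 < l) (hr : 0 < r) (hp : 0 < p) (hpl : p ≤ l)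
    (U Uh : Matrix (Fin (k + l)) (Fin r) ℝ)
    (hU : Uᵀ * U = 1) (hUh : Uhᵀ * Uh = 1)
    (s : ℝ) (hs : 0 < s)
    (hMh : ∀ x : Fin r → ℝ,
      s * euclNorm x ≤ euclNorm ((Uh.submatrix (Fin.castAdd l) id).mulVec x))
    (κ : ℝ) (hκdef : κ = (1 / Real.sqrt 2) * frobNorm (U * Uᵀ - Uh * Uhᵀ))
    (hκ : κ ≤ s / (2 * Real.sqrt 2)) :
    (U.submatrix (Fin.castAdd l) id).rank = r ∧
    (∀ x : Fin r → ℝ,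
      (s / 2) * euclNorm x ≤ euclNorm ((U.submatrix (Fin.castAdd l) id).mulVec x)) ∧
    ∀ b : Fin k → ℝ,
      euclNorm
        (((Uh.submatrix (fun i : Fin p => Fin.natAdd k (Fin.castLE hpl i)) id) *
            pinv (Uh.submatrix (Fin.castAdd l) id)).mulVec b -
         ((U.submatrix (fun i : Fin p => Fin.natAdd k (Fin.castLE hpl i)) id) *
            pinv (U.submatrix (Fin.castAdd l) id)).mulVec b)
      ≤ (2 * (1 + Real.sqrt 5) *
            specNorm (Uh.submatrix (fun i : Fin p => Fin.natAdd k (Fin.castLE hpl i)) id) / s ^ 2 +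
          1 / s) * Real.sqrt 2 * κ * euclNorm b := by
  set A := Uh.submatrix (Fin.castAdd l) id
  set M := U.submatrix (Fin.castAdd l) id
  set Yh := Uh.submatrix (fun i : Fin p => Fin.natAdd k (Fin.castLE hpl i)) id
  set Y := U.submatrix (fun i : Fin p => Fin.natAdd k (Fin.castLE hpl i)) id
  set G := Uᵀ * Uh
  have hκE : frobNorm (U * G - Uh) = κ := by rw [hκdef, frobNorm_proj_sub U Uh hU hUh]
  have hκ0 : 0 ≤ κ := hκE ▸ frobNorm_nonneg _
  have hs2 : Real.sqrt 2 ^ 2 = 2 := Real.sq_sqrt (by norm_num)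
  have hs2pos : 0 < Real.sqrt 2 := by positivity
  have hs2one : 1 ≤ Real.sqrt 2 := Real.one_le_sqrt.mpr (by norm_num)
  have hκs : 2 * Real.sqrt 2 * κ ≤ s := by
    rw [le_div_iff₀ (by positivity)] at hκ
    linarith
  have hκ2 : 2 * κ ≤ s := by nlinarith
  have hκ8 : 8 * κ ^ 2 ≤ s ^ 2 := by
    have := pow_le_pow_left₀ (by positivity) hκs 2
    rw [mul_pow, mul_pow, hs2] at this
    linarith
  have hblocks : ∀ x, euclNorm ((M * G - A) *ᵥ x) ^ 2 + euclNorm ((Y * G - Yh) *ᵥ x) ^ 2 ≤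
      (κ * euclNorm x) ^ 2 := fun x =>
    (euclNorm_sq_blocks_le hpl ((U * G - Uh) *ᵥ x)).trans
      (pow_le_pow_left₀ (euclNorm_nonneg _) (hκE ▸ euclNorm_mulVec_le_frobNorm _ x) 2)
  have hE : ∀ x, euclNorm ((M * G - A) *ᵥ x) ≤ κ * euclNorm x := fun x =>
    le_of_sq_le_sq ((le_add_of_nonneg_right (sq_nonneg _)).trans (hblocks x))
      (mul_nonneg hκ0 (euclNorm_nonneg _))
  have hMG : ∀ x, (s / 2) * euclNorm x ≤ euclNorm ((M * G) *ᵥ x) := fun x => by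
    have h1 := euclNorm_sub_le ((M * G) *ᵥ x) ((M * G - A) *ᵥ x)
    rw [← Matrix.sub_mulVec, sub_sub_cancel] at h1
    nlinarith [hMh x, hE x, euclNorm_nonneg x]
  have hGinj : Function.Injective G.mulVec := by
    have h := mulVec_injective_of_lower_bound (half_pos hs) hMG
    intro x y hxy
    apply h
    simp only [← Matrix.mulVec_mulVec]
    exact congrArg _ hxy
  have hGsurj : Function.Surjective G.mulVec :=
    LinearMap.surjective_of_injective (f := G.mulVecLin) hGinj
  have hGle : ∀ x, euclNorm (G *ᵥ x) ≤ euclNorm x := fun x => by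
    have iso : ∀ V : Matrix (Fin (k + l)) (Fin r) ℝ, Vᵀ * V = 1 → ∀ z,
        (V *ᵥ z) ⬝ᵥ (V *ᵥ z) = z ⬝ᵥ z := fun V hV z => by
      rw [Matrix.dotProduct_mulVec, ← Matrix.mulVec_transpose, Matrix.mulVec_mulVec, hV,
        Matrix.one_mulVec]
    have h1 : euclNorm (U *ᵥ (G *ᵥ x)) = euclNorm (G *ᵥ x) :=
      (sq_eq_sq₀ (euclNorm_nonneg _) (euclNorm_nonneg _)).mp
        (by rw [euclNorm_sq, euclNorm_sq, iso U hU])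
    have h2 : euclNorm (Uh *ᵥ x) = euclNorm x :=
      (sq_eq_sq₀ (euclNorm_nonneg _) (euclNorm_nonneg _)).mp
        (by rw [euclNorm_sq, euclNorm_sq, iso Uh hUh])
    have h3 : euclNorm (G *ᵥ x) ^ 2 = (U *ᵥ (G *ᵥ x)) ⬝ᵥ (Uh *ᵥ x) := by
      have h : Uᵀ *ᵥ (Uh *ᵥ x) = G *ᵥ x := Matrix.mulVec_mulVec _ _ _
      rw [euclNorm_sq, dotProduct_comm (U *ᵥ _), Matrix.dotProduct_mulVec (Uh *ᵥ x) U,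
        ← Matrix.mulVec_transpose, h]
    have h4 := (le_abs_self _).trans (abs_dotProduct_le (U *ᵥ (G *ᵥ x)) (Uh *ᵥ x))
    rw [← h3, h1, h2] at h4
    nlinarith [euclNorm_nonneg (G *ᵥ x), euclNorm_nonneg x]
  clear_value A M Y Yh G
  have hM : ∀ x, (s / 2) * euclNorm x ≤ euclNorm (M *ᵥ x) := fun x => by
    obtain ⟨y, rfl⟩ := hGsurj x
    rw [Matrix.mulVec_mulVec]
    exact (mul_le_mul_of_nonneg_left (hGle y) (half_pos hs).le).trans (hMG y)
  have hMinj := mulVec_injective_of_lower_bound (half_pos hs) hM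
  have hAinj := mulVec_injective_of_lower_bound hs hMh
  refine ⟨?_, hM, fun b => ?_⟩
  · rw [Matrix.rank, LinearMap.finrank_range_of_inj (f := M.mulVecLin) hMinj]
    simp
  obtain ⟨x, hx⟩ := hGsurj (pinv M *ᵥ b)
  have hnx : (M * G)ᵀ *ᵥ ((M * G) *ᵥ x) = (M * G)ᵀ *ᵥ b := by
    rw [Matrix.transpose_mul, ← Matrix.mulVec_mulVec, ← Matrix.mulVec_mulVec,
      ← Matrix.mulVec_mulVec, hx, transpose_mulVec_mulVec_pinv hMinj]
  obtain ⟨hBx, hd⟩ := leastSquares_sub_le hs hκ0 hκ2 hMh hE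
    (transpose_mulVec_mulVec_pinv hAinj b) hnx
  have hE2 : euclNorm ((Y * G - Yh) *ᵥ x) ≤ Real.sqrt 2 * κ / s * euclNorm b := by
    have hb0 := euclNorm_nonneg b
    have hx0 := euclNorm_nonneg x
    have hE1 : s * euclNorm x - euclNorm b ≤ euclNorm ((M * G - A) *ᵥ x) := by
      have h1 := euclNorm_sub_le ((M * G) *ᵥ x) ((M * G - A) *ᵥ x)
      rw [← Matrix.sub_mulVec, sub_sub_cancel] at h1
      linarith [hMh x]
    have hbl := hblocks x
    rw [div_mul_eq_mul_div, le_div_iff₀ hs]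
    refine le_of_sq_le_sq ?_ (by positivity)
    rw [mul_pow, mul_pow, mul_pow, hs2]
    set t := euclNorm x
    set β := euclNorm b
    set e := euclNorm ((M * G - A) *ᵥ x)
    set f := euclNorm ((Y * G - Yh) *ᵥ x)
    rcases le_total (s * t) β with h | h
    · have h2 : (s * t) ^ 2 ≤ β ^ 2 := pow_le_pow_left₀ (by positivity) h 2
      have h3 := mul_le_mul_of_nonneg_left h2 (sq_nonneg κ)
      have h4 : f ^ 2 ≤ (κ * t) ^ 2 := by nlinarith [sq_nonneg e]
      have h5 := mul_le_mul_of_nonneg_right h4 (sq_nonneg s)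
      nlinarith [mul_nonneg (sq_nonneg κ) (sq_nonneg β)]
    · have h2 : (s * t - β) ^ 2 ≤ e ^ 2 := pow_le_pow_left₀ (by linarith) hE1 2
      have h3 : f ^ 2 * s ^ 2 ≤ ((κ * t) ^ 2 - (s * t - β) ^ 2) * s ^ 2 :=
        mul_le_mul_of_nonneg_right (by linarith) (sq_nonneg s)
      have h4 := mul_le_mul_of_nonneg_right hκ8 (sq_nonneg (s * t - β))
      have h5 : 0 ≤ κ ^ 2 * (7 * (s * t) ^ 2 - 16 * (s * t) * β + 10 * β ^ 2) :=
        mul_nonneg (sq_nonneg κ) (by nlinarith [sq_nonneg (7 * (s * t) - 8 * β), sq_nonneg β])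
      nlinarith
  have hsplit : (Yh * pinv A) *ᵥ b - (Y * pinv M) *ᵥ b =
      Yh *ᵥ (pinv A *ᵥ b - x) - (Y * G - Yh) *ᵥ x := by
    rw [← Matrix.mulVec_mulVec, ← Matrix.mulVec_mulVec, ← hx, Matrix.mulVec_sub,
      Matrix.sub_mulVec, ← Matrix.mulVec_mulVec]
    abel
  have hY0 := specNorm_nonneg Yh
  have hb0 := euclNorm_nonneg b
  have hconst : 3 ≤ 2 * (1 + Real.sqrt 5) * Real.sqrt 2 := by
    have : 1 ≤ Real.sqrt 5 := Real.one_le_sqrt.mpr (by norm_num)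
    nlinarith
  rw [hsplit]
  calc euclNorm (Yh *ᵥ (pinv A *ᵥ b - x) - (Y * G - Yh) *ᵥ x)
      ≤ specNorm Yh * (3 * κ / s ^ 2 * euclNorm b) + Real.sqrt 2 * κ / s * euclNorm b :=
        (euclNorm_sub_le _ _).trans (add_le_add
          ((euclNorm_mulVec_le_specNorm _ _).trans (mul_le_mul_of_nonneg_left hd hY0)) hE2)
    _ = 3 * (specNorm Yh * κ / s ^ 2 * euclNorm b) + Real.sqrt 2 * κ / s * euclNorm b := by ring
    _ ≤ 2 * (1 + Real.sqrt 5) * Real.sqrt 2 * (specNorm Yh * κ / s ^ 2 * euclNorm b) +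
          Real.sqrt 2 * κ / s * euclNorm b := by gcongr
    _ = _ := by ring
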